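/- Let W be a finite group acting faithfully on a finite-dimensional complex vector space 𝔥 as a group generated by reflections, let μ ∈ 𝔥* be a linear functional, and let W₀ = Stab_W(μ). Then W₀ is generated by the reflections in W that fix μ. -/

import Mathlib

/-- A `g` in a group acting linearly on `𝔥` (via `ρ`) acts as a reflection if `g ≠ 1` and
its fixed subspace is a hyperplane. -/
def IsReflectionOn {𝔥 : Type*} [AddCommGroup 𝔥] [Module ℂ 𝔥]
    {G : Type*} [Group G] (ρ : G →* (𝔥 ≃ₗ[ℂ] 𝔥)) (g : G) : Prop :=
  g ≠ 1 ∧ Module.finrank ℂ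
      (LinearMap.ker ((ρ g).toLinearMap - LinearMap.id)) = Module.finrank ℂ 𝔥 - 1

namespace SteinbergAux

open Finset

set_option linter.unusedSectionVars false

/-- Abstract data of a group with reflections acting on a ring. -/
structure RD (G S : Type*) [Group G] [CommRing S] [Algebra ℂ S] [MulSemiringAction G S] where
  refl : Set G
  α : G → S
  χ : G →* ℂ
  prime : ∀ s ∈ refl, Prime (α s)
  eig : ∀ s ∈ refl, ∀ g : G, (∀ f : S, α s ∣ g • f - f) → g • α s = χ g • α s
  inj : ∀ s ∈ refl, ∀ g : G, (∀ f : S, α s ∣ g • f - f) → χ g = 1 → g = 1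
  memC : ∀ s ∈ refl, ∀ g : G, ((∀ f : S, α s ∣ g • f - f) ↔
    g = 1 ∨ (g ∈ refl ∧ Associated (α s) (α g)))
  ne_one : (1 : G) ∉ refl
  conj_mem : ∀ s ∈ refl, ∀ g : G, g * s * g⁻¹ ∈ refl
  conj_root : ∀ s ∈ refl, ∀ g : G, ∃ c : ℂ, g • α s = c • α (g * s * g⁻¹)

section Abstract

variable {G S : Type*} [Group G] [Fintype G] [CommRing S] [IsDomain S]
  [UniqueFactorizationMonoid S] [Algebra ℂ S] [MulSemiringAction G S] [SMulCommClass G ℂ S]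

namespace RD

variable (D : RD G S)

lemma χ_ne (g : G) : D.χ g ≠ 0 := by
  intro h
  have := D.χ.map_mul g g⁻¹
  simp [h] at this

lemma χ_inv (g : G) : D.χ g⁻¹ = (D.χ g)⁻¹ := by
  have := D.χ.map_mul g g⁻¹
  simp only [mul_inv_cancel, map_one] at this
  exact eq_inv_of_mul_eq_one_right this.symm

/-- The group of elements acting trivially modulo the root of `s`. -/
def C (s : G) : Subgroup G where
  carrier := {g | ∀ f : S, D.α s ∣ g • f - f}
  mul_mem' := by
    intro a b ha hb f
    have := dvd_add (ha (b • f)) (hb f)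
    simpa [mul_smul] using this
  one_mem' := by intro f; simp
  inv_mem' := by
    intro a ha f
    have := ha (a⁻¹ • f)
    rw [smul_inv_smul] at this
    exact (dvd_sub_comm).1 this

lemma mem_C {s g : G} : g ∈ D.C s ↔ ∀ f : S, D.α s ∣ g • f - f := Iff.rfl

lemma self_mem_C {s : G} (hs : s ∈ D.refl) : s ∈ D.C s :=
  (D.memC s hs s).2 (Or.inr ⟨hs, Associated.refl _⟩)

lemma char_eq {s : G} (hs : s ∈ D.refl) {g : G} (hg : g ∈ D.C s) {F' : S} {m : ℕ} {ψ : ℂ}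
    (h : g • (D.α s ^ m * F') = ψ • (D.α s ^ m * F')) (hF' : ¬ D.α s ∣ F') :
    ψ = D.χ g ^ m := by
  by_contra hne
  apply hF'
  have h0 : D.α s ≠ 0 := (D.prime s hs).ne_zero
  rw [smul_mul', smul_pow', D.eig s hs g hg, smul_pow, smul_mul_assoc,
    ← mul_smul_comm, ← mul_smul_comm] at h
  have h1 := mul_left_cancel₀ (pow_ne_zero m h0) h
  have h2 : (ψ - D.χ g ^ m) • F' = D.χ g ^ m • (g • F' - F') := by
    rw [sub_smul, smul_sub, h1]
  have h3 : F' = (ψ - D.χ g ^ m)⁻¹ • (D.χ g ^ m • (g • F' - F')) := by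
    rw [← h2, smul_smul, inv_mul_cancel₀ (sub_ne_zero.2 hne), one_smul]
  rw [h3]
  exact dvd_smul_of_dvd _ (dvd_smul_of_dvd _ (hg F'))

open scoped Classical in
/-- Reflections lying in a subgroup. -/
noncomputable def reflIn (K : Subgroup G) : Finset G := univ.filter (fun s => s ∈ K ∧ s ∈ D.refl)

/-- Product of the roots. -/
noncomputable def J (K : Subgroup G) : S := ∏ s ∈ D.reflIn K, D.α s

open scoped Classical in
/-- Antisymmetrisation. -/
noncomputable def anti (K : Subgroup G) : S →ₗ[ℂ] S where
  toFun f := ∑ k ∈ univ.filter (fun k => k ∈ K), D.χ k • k • f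
  map_add' f h := by simp [sum_add_distrib]
  map_smul' c f := by
    simp only [smul_sum, RingHom.id_apply]
    refine sum_congr rfl fun k _ => ?_
    rw [smul_comm k c f, smul_comm]

open scoped Classical in
lemma anti_apply (K : Subgroup G) (f : S) :
    D.anti K f = ∑ k ∈ univ.filter (fun k => k ∈ K), D.χ k • k • f := rfl

lemma J_ne (K : Subgroup G) : D.J K ≠ 0 := by
  rw [J, prod_ne_zero_iff]
  intro s hs
  simp only [reflIn, mem_filter] at hs
  exact (D.prime s hs.2.2).ne_zero

open scoped Classical in
lemma emult_J (K : Subgroup G) {s : G} (hs : s ∈ D.refl) :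
    emultiplicity (D.α s) (D.J K) + 1 =
      ((univ.filter (fun g => g ∈ K ∧ g ∈ D.C s)).card : ℕ∞) := by
  rw [J, Finset.emultiplicity_prod (D.prime s hs)]
  have h1 : ∀ t ∈ D.reflIn K, emultiplicity (D.α s) (D.α t) =
      if Associated (D.α s) (D.α t) then 1 else 0 := by
    intro t ht
    simp only [reflIn, mem_filter] at ht
    have hp := D.prime s hs
    have hq := D.prime t ht.2.2
    split_ifs with ha
    · rw [← emultiplicity_eq_of_associated_right ha]
      exact (FiniteMultiplicity.of_prime_left hp hp.ne_zero).emultiplicity_self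
    · rw [emultiplicity_eq_zero]
      intro hd
      exact ha (hp.irreducible.associated_of_dvd hq.irreducible hd)
  rw [sum_congr rfl h1, sum_boole]
  have h2 : univ.filter (fun g => g ∈ K ∧ g ∈ D.C s) =
      insert 1 ((D.reflIn K).filter (fun t => Associated (D.α s) (D.α t))) := by
    ext g
    simp only [mem_filter, mem_univ, true_and, mem_insert, reflIn, mem_C, D.memC s hs g]
    constructor
    · rintro ⟨h, h' | h'⟩
      · exact Or.inl h'
      · exact Or.inr ⟨⟨h, h'.1⟩, h'.2⟩
    · rintro (rfl | h)
      · exact ⟨K.one_mem, Or.inl rfl⟩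
      · exact ⟨h.1.1, Or.inr ⟨h.1.2, h.2⟩⟩
  rw [h2, card_insert_of_notMem]
  · simp
  · simp [reflIn, D.ne_one]

open scoped Classical in
lemma smul_anti (K : Subgroup G) {g : G} (hg : g ∈ K) (f : S) :
    g • D.anti K f = (D.χ g)⁻¹ • D.anti K f := by
  rw [anti_apply, smul_sum, smul_sum]
  refine sum_bij (fun k _ => g * k) ?_ ?_ ?_ ?_
  · intro k hk
    simp only [mem_filter, mem_univ, true_and] at hk ⊢
    exact K.mul_mem hg hk
  · intro a _ b _ h
    exact mul_left_cancel h
  · intro b hb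
    simp only [mem_filter, mem_univ, true_and] at hb
    exact ⟨g⁻¹ * b, by simpa using K.mul_mem (K.inv_mem hg) hb, by simp⟩
  · intro k _
    rw [smul_comm g (D.χ k), map_mul, mul_smul (D.χ g), inv_smul_smul₀ (D.χ_ne g), mul_smul g k f]

open scoped Classical in
lemma J_dvd (K : Subgroup G) (f : S) : D.J K ∣ D.anti K f := by
  by_cases hF : D.anti K f = 0
  · rw [hF]; exact dvd_zero _
  rw [UniqueFactorizationMonoid.dvd_iff_emultiplicity_le (D.J_ne K)]
  intro p hp
  by_cases hpJ : p ∣ D.J K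
  swap
  · rw [emultiplicity_eq_zero.2 hpJ]; exact zero_le
  obtain ⟨s, hsK, hps⟩ := (Prime.dvd_finsetProd_iff hp _).1 hpJ
  simp only [reflIn, mem_filter, mem_univ, true_and] at hsK
  have hs := hsK.2
  have hass := hp.irreducible.associated_of_dvd (D.prime s hs).irreducible hps
  rw [← emultiplicity_eq_of_associated_left hass, ← emultiplicity_eq_of_associated_left hass]
  have hfin := FiniteMultiplicity.of_prime_left (D.prime s hs) hF
  obtain ⟨F', hF', hnd⟩ := hfin.exists_eq_pow_mul_and_not_dvd
  rw [hfin.emultiplicity_eq_multiplicity]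
  set m := multiplicity (D.α s) (D.anti K f) with hm
  rw [← ENat.add_le_add_iff_right ENat.one_ne_top, D.emult_J K hs]
  have hroots : (univ.filter (fun g => g ∈ K ∧ g ∈ D.C s)).card ≤
      (Polynomial.nthRootsFinset (m+1) (1:ℂ)).card := by
    refine card_le_card_of_injOn D.χ ?_ ?_
    · intro g hg
      simp only [coe_filter, mem_univ, true_and, Set.mem_ofPred_eq] at hg
      have h1 := D.smul_anti K hg.1 f
      rw [hF'] at h1
      have h2 := D.char_eq hs hg.2 h1 hnd
      rw [mem_coe, Polynomial.mem_nthRootsFinset (Nat.succ_pos m), pow_succ, ← h2,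
        inv_mul_cancel₀ (D.χ_ne g)]
    · intro a ha b hb hab
      simp only [coe_filter, mem_univ, true_and, Set.mem_ofPred_eq] at ha hb
      have : a * b⁻¹ = 1 := D.inj s hs _ ((D.C s).mul_mem ha.2 ((D.C s).inv_mem hb.2)) (by
        rw [map_mul, χ_inv, hab, mul_inv_cancel₀ (D.χ_ne b)])
      exact mul_inv_eq_one.1 this
  have h3 : (Polynomial.nthRootsFinset (m+1) (1:ℂ)).card ≤ m + 1 := by
    rw [Polynomial.nthRootsFinset]
    exact (Multiset.toFinset_card_le _).trans (Polynomial.card_nthRoots _ _)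
  exact_mod_cast hroots.trans h3

/-- The divided antisymmetrisation. -/
noncomputable def Phi (K : Subgroup G) : S →ₗ[ℂ] S where
  toFun f := (D.J_dvd K f).choose
  map_add' f h := by
    apply mul_left_cancel₀ (D.J_ne K)
    rw [mul_add, ← (D.J_dvd K f).choose_spec, ← (D.J_dvd K h).choose_spec,
      ← (D.J_dvd K (f + h)).choose_spec, map_add]
  map_smul' c f := by
    apply mul_left_cancel₀ (D.J_ne K)
    rw [RingHom.id_apply, mul_smul_comm, ← (D.J_dvd K f).choose_spec,
      ← (D.J_dvd K (c • f)).choose_spec, map_smul]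

lemma J_mul_Phi (K : Subgroup G) (f : S) : D.J K * D.Phi K f = D.anti K f :=
  (D.J_dvd K f).choose_spec.symm

lemma smul_J (K : Subgroup G) {g : G} (hg : ∀ k, k ∈ K ↔ g * k * g⁻¹ ∈ K) :
    ∃ c : ℂ, g • D.J K = c • D.J K := by
  have h : ∀ s : G, ∃ c : ℂ, s ∈ D.refl → g • D.α s = c • D.α (g * s * g⁻¹) := by
    intro s
    by_cases hs : s ∈ D.refl
    · obtain ⟨c, hc⟩ := D.conj_root s hs g
      exact ⟨c, fun _ => hc⟩
    · exact ⟨0, fun h => absurd h hs⟩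
  choose c hc using h
  refine ⟨∏ s ∈ D.reflIn K, c s, ?_⟩
  have h1 : g • D.J K = ∏ s ∈ D.reflIn K, c s • D.α (g * s * g⁻¹) := by
    rw [J, smul_prod']
    refine prod_congr rfl fun s hs => hc s ?_
    simp only [reflIn, mem_filter] at hs
    exact hs.2.2
  have h2 : ∏ s ∈ D.reflIn K, D.α (g * s * g⁻¹) = D.J K := by
    rw [J]
    refine prod_bij (fun s _ => g * s * g⁻¹) ?_ ?_ ?_ ?_
    · intro s hs
      simp only [reflIn, mem_filter, mem_univ, true_and] at hs ⊢
      exact ⟨(hg s).1 hs.1, D.conj_mem s hs.2 g⟩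
    · intro a _ b _ hab
      simpa using hab
    · intro t ht
      simp only [reflIn, mem_filter, mem_univ, true_and] at ht
      refine ⟨g⁻¹ * t * g, ?_, by group⟩
      simp only [reflIn, mem_filter, mem_univ, true_and]
      refine ⟨(hg _).2 ?_, by simpa using D.conj_mem t ht.2 g⁻¹⟩
      have : g * (g⁻¹ * t * g) * g⁻¹ = t := by group
      rw [this]; exact ht.1
    · intro _ _; rfl
  rw [h1, ← h2, prod_smul]

open scoped Classical in
lemma smul_Phi_top_of_refl {s : G} (hs : s ∈ D.refl) (f : S) :
    s • D.Phi ⊤ f = D.Phi ⊤ f := by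
  obtain ⟨ψ, hψ⟩ := D.smul_J ⊤ (g := s) (by simp)
  have hfin := FiniteMultiplicity.of_prime_left (D.prime s hs) (D.J_ne ⊤)
  obtain ⟨F', hF', hnd⟩ := hfin.exists_eq_pow_mul_and_not_dvd
  have hmul := D.emult_J ⊤ hs
  rw [hfin.emultiplicity_eq_multiplicity] at hmul
  set m := multiplicity (D.α s) (D.J ⊤) with hm
  have h1 : ψ = D.χ s ^ m := by
    refine D.char_eq hs (D.self_mem_C hs) ?_ hnd
    rw [← hF', hψ]
  have h2 : D.χ s ^ (m + 1) = 1 := by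
    have hc : m + 1 = Nat.card (D.C s) := by
      have : m + 1 = (univ.filter (fun g => g ∈ (⊤ : Subgroup G) ∧ g ∈ D.C s)).card := by
        exact_mod_cast hmul
      rw [this, Nat.card_eq_fintype_card, Fintype.card_subtype]
      simp
    have h3 : (⟨s, D.self_mem_C hs⟩ : D.C s) ^ (m + 1) = 1 := by
      rw [hc]; exact pow_card_eq_one'
    have h4 : s ^ (m + 1) = 1 := by
      simpa using congrArg Subtype.val h3
    rw [← map_pow, h4, map_one]
  have h5 : ψ = (D.χ s)⁻¹ := by
    rw [h1]
    exact eq_inv_of_mul_eq_one_left (by rw [← pow_succ, h2])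
  have h6 := D.smul_anti ⊤ (Subgroup.mem_top s) f
  rw [← J_mul_Phi, smul_mul', hψ, h5, smul_mul_assoc] at h6
  have h7 := smul_right_injective S (inv_ne_zero (D.χ_ne s)) h6
  exact mul_left_cancel₀ (D.J_ne ⊤) h7

lemma smul_Phi_top (hgen : Subgroup.closure D.refl = ⊤) (g : G) (f : S) :
    g • D.Phi ⊤ f = D.Phi ⊤ f := by
  have : Subgroup.closure D.refl ≤ MulAction.stabilizer G (D.Phi ⊤ f) := by
    rw [Subgroup.closure_le]
    intro s hs
    exact D.smul_Phi_top_of_refl hs f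
  rw [hgen] at this
  exact this (Subgroup.mem_top g)

end RD

lemma exists_det_ne {V : Type*} [AddCommGroup V] [Module ℂ V] (L : V →ₗ[ℂ] Module.Dual ℂ V)
    (m : ℕ) (h : (m : Cardinal) ≤ L.rank) :
    ∃ f h : Fin m → V, (Matrix.of fun i j => L (f i) (h j)).det ≠ 0 := by
  obtain ⟨v, hv⟩ := exists_linearIndependent_of_le_rank
    (R := ℂ) (M := LinearMap.range L) (n := m) h
  have hv' : LinearIndependent ℂ (fun i => ((v i : Module.Dual ℂ V) : V → ℂ)) := by
    have h1 := hv.map' (LinearMap.range L).subtype (Submodule.ker_subtype _)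
    have h2 := h1.map' (LinearMap.ltoFun ℂ V ℂ ℂ) (by
      rw [LinearMap.ker_eq_bot]
      intro a b hab
      exact LinearMap.coe_injective hab)
    exact h2
  choose f hf using fun i => (v i).2
  have hspan := span_flip_eq_top_iff_linearIndependent.2 hv'
  have hsurj : ∀ j : Fin m, ∃ x : V, ∀ i, (v i : Module.Dual ℂ V) x = if i = j then 1 else 0 := by
    intro j
    have hmem : (fun i => if i = j then (1:ℂ) else 0) ∈ Submodule.span ℂ
      (Set.range (flip (fun i => ((v i : Module.Dual ℂ V) : V → ℂ)))) := by
      rw [hspan]; trivial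
    have hle : Submodule.span ℂ (Set.range (flip (fun i => ((v i : Module.Dual ℂ V) : V → ℂ)))) ≤
        LinearMap.range (LinearMap.pi (fun i => (v i : Module.Dual ℂ V))) := by
      rw [Submodule.span_le]
      rintro _ ⟨x, rfl⟩
      exact ⟨x, rfl⟩
    obtain ⟨x, hx⟩ := hle hmem
    exact ⟨x, fun i => congrFun hx i⟩
  choose h hh using hsurj
  refine ⟨f, h, ?_⟩
  have : (Matrix.of fun i j => L (f i) (h j)) = 1 := by
    ext i j
    simp only [Matrix.of_apply, hf, hh, Matrix.one_apply]
  rw [this]; simp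

lemma le_rank_of_det {V : Type*} [AddCommGroup V] [Module ℂ V] (L : V →ₗ[ℂ] Module.Dual ℂ V)
    (m : ℕ) (f h : Fin m → V) (hd : (Matrix.of fun i j => L (f i) (h j)).det ≠ 0) :
    (m : Cardinal) ≤ L.rank := by
  have hli : LinearIndependent ℂ (fun i => L.rangeRestrict (f i)) := by
    rw [Fintype.linearIndependent_iff]
    intro c hc
    by_contra hne
    push Not at hne
    obtain ⟨i, hi⟩ := hne
    apply hd
    rw [← Matrix.exists_vecMul_eq_zero_iff]
    refine ⟨c, fun h0 => hi (congrFun h0 i), ?_⟩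
    ext j
    have h1 := congrArg (fun x : LinearMap.range L => (x : Module.Dual ℂ V) (h j)) hc
    simpa [Matrix.vecMul, dotProduct] using h1
  simpa using hli.cardinal_lift_le_rank

lemma det_eq_zero_of_factor {R : Type*} [CommRing R] [IsDomain R] {ι : Type*} [Fintype ι]
    {m : ℕ} (h : Fintype.card ι < m)
    (A : Matrix (Fin m) ι R) (B : Matrix ι (Fin m) R) : (A * B).det = 0 := by
  let K := FractionRing R
  apply IsFractionRing.injective R K
  rw [map_zero, RingHom.map_det, RingHom.mapMatrix_apply, Matrix.map_mul]
  by_contra hne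
  have h1 := Matrix.rank_of_isUnit _ ((Matrix.isUnit_iff_isUnit_det _).2 (Ne.isUnit hne))
  have h2 := Matrix.rank_mul_le_left (A.map (algebraMap R K)) (B.map (algebraMap R K))
  have h3 := Matrix.rank_le_card_width (A.map (algebraMap R K))
  rw [h1, Fintype.card_fin] at h2
  omega

namespace RD

variable (D : RD G S)

/-- The bilinear form at a point. -/
noncomputable def B (K : Subgroup G) (ε : S →ₐ[ℂ] ℂ) : S →ₗ[ℂ] Module.Dual ℂ S :=
  LinearMap.compr₂ (LinearMap.mul ℂ S) (ε.toLinearMap ∘ₗ D.Phi K)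

lemma B_apply (K : Subgroup G) (ε : S →ₐ[ℂ] ℂ) (f h : S) :
    D.B K ε f h = ε (D.Phi K (f * h)) := rfl

open scoped Classical in
lemma rank_B_le (K : Subgroup G) (ε : S →ₐ[ℂ] ℂ) : (D.B K ε).rank ≤ (Nat.card K : Cardinal) := by
  by_contra hlt
  rw [not_le] at hlt
  have h1 : ((Nat.card K + 1 : ℕ) : Cardinal) ≤ (D.B K ε).rank := by
    have := Order.succ_le_of_lt hlt
    rw [Cardinal.succ_natCast] at this
    exact_mod_cast this
  obtain ⟨f, h, hd⟩ := exists_det_ne _ _ h1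
  apply hd
  have h2 : (Matrix.of fun i j => D.B K ε (f i) (h j)) =
      (Matrix.of fun i j => D.Phi K (f i * h j)).map ε := by
    ext i j; rfl
  have h3 : (D.J K) • (Matrix.of fun i j => D.Phi K (f i * h j)) =
      (Matrix.of fun i (k : K) => D.χ k • (k : G) • f i) * Matrix.of fun (k : K) j => (k : G) • h j := by
    ext i j
    rw [Matrix.smul_apply, Matrix.of_apply, smul_eq_mul, J_mul_Phi, anti_apply, Matrix.mul_apply,
      sum_subtype (p := fun k => k ∈ K) _ (by simp)]
    refine sum_congr rfl fun k _ => ?_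
    simp only [Matrix.of_apply]
    rw [smul_mul' (k : G) (f i) (h j), smul_mul_assoc (D.χ k)]
  have h4 : (Matrix.of fun i j => D.Phi K (f i * h j)).det = 0 := by
    have := det_eq_zero_of_factor (m := Nat.card K + 1)
      (by rw [Nat.card_eq_fintype_card]; omega) (Matrix.of fun i (k : K) => D.χ k • (k : G) • f i)
      (Matrix.of fun (k : K) j => (k : G) • h j)
    rw [← h3, Matrix.det_smul] at this
    exact (mul_eq_zero.1 this).resolve_left (pow_ne_zero _ (D.J_ne K))
  rw [h2]
  have := RingHom.map_det (ε : S →+* ℂ) (Matrix.of fun i j => D.Phi K (f i * h j))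
  rw [h4, map_zero] at this
  exact this.symm

/-- Step 3: the rank at a point is at most `[G : G_v] |H|`. -/
lemma rank_B_top_le (H St : Subgroup G) (ε : S →ₐ[ℂ] ℂ)
    (hSt : ∀ k ∈ St, ∀ f : S, ε (k • f) = ε f)
    (hnorm : ∀ k ∈ St, ∀ h, h ∈ H ↔ k * h * k⁻¹ ∈ H)
    (hrefl : ∀ s ∈ D.refl, ε (D.α s) = 0 → s ∈ H) :
    (D.B ⊤ ε).rank ≤ ((St.index * Nat.card H : ℕ) : Cardinal) := by
  classical
  -- behaviour of `Phi H` under `St`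
  have hψ : ∀ k : G, ∃ c : ℂ, k ∈ St → ∀ f, ε (D.Phi H (k • f)) = c * ε (D.Phi H f) := by
    intro k
    by_cases hk : k ∈ St
    swap
    · exact ⟨0, fun h => absurd h hk⟩
    obtain ⟨c, hc⟩ := D.smul_J H (hnorm k hk)
    refine ⟨c, fun _ f => ?_⟩
    have h1 : D.anti H (k • f) = k • D.anti H f := by
      rw [anti_apply, anti_apply, smul_sum]
      symm
      refine sum_bij (fun h _ => k * h * k⁻¹) ?_ ?_ ?_ ?_
      · intro h hh
        simp only [mem_filter, mem_univ, true_and] at hh ⊢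
        exact (hnorm k hk h).1 hh
      · intro a _ b _ hab
        simpa using hab
      · intro t ht
        simp only [mem_filter, mem_univ, true_and] at ht
        have e : k * (k⁻¹ * t * k) * k⁻¹ = t := by group
        refine ⟨k⁻¹ * t * k, ?_, e⟩
        simp only [mem_filter, mem_univ, true_and]
        refine (hnorm k hk _).2 ?_
        rw [e]; exact ht
      · intro h _
        rw [smul_comm k (D.χ h), smul_smul, smul_smul, inv_mul_cancel_right]
        congr 1
        rw [map_mul, map_mul, χ_inv, mul_comm (D.χ k), mul_assoc, mul_inv_cancel₀ (D.χ_ne k),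
          mul_one]
    have h2 : D.Phi H (k • f) = c • k • D.Phi H f := by
      apply mul_left_cancel₀ (D.J_ne H)
      rw [J_mul_Phi, h1, ← J_mul_Phi, smul_mul', hc, smul_mul_assoc, mul_smul_comm c]
    rw [h2, map_smul, hSt k hk, smul_eq_mul]
  choose ψ hψ using hψ
  -- factor J
  obtain ⟨u, hu, hεu⟩ : ∃ u : S, D.J ⊤ = D.J H * u ∧ ε u ≠ 0 := by
    refine ⟨∏ s ∈ D.reflIn ⊤ \ D.reflIn H, D.α s, ?_, ?_⟩
    · rw [J, J, mul_comm, prod_sdiff]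
      intro s hs
      simp only [reflIn, mem_filter, mem_univ, true_and, Subgroup.mem_top] at hs ⊢
      exact hs.2
    · rw [map_prod, prod_ne_zero_iff]
      intro s hs h0
      simp only [reflIn, mem_filter, mem_univ, true_and, Subgroup.mem_top, mem_sdiff] at hs
      exact hs.2 ⟨hrefl s hs.1 h0, hs.1⟩
  -- sum formula
  have hsum : ∀ f, (Nat.card H : ℂ) • (u * D.Phi ⊤ f) = ∑ g : G, D.χ g • D.Phi H (g • f) := by
    intro f
    apply mul_left_cancel₀ (D.J_ne H)
    rw [mul_smul_comm, ← mul_assoc, ← hu, J_mul_Phi, mul_sum]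
    have h1 : ∀ g : G, D.J H * D.χ g • D.Phi H (g • f) =
        ∑ h ∈ univ.filter (fun k => k ∈ H), D.χ (h * g) • (h * g) • f := by
      intro g
      rw [mul_smul_comm, J_mul_Phi, anti_apply, smul_sum]
      refine sum_congr rfl fun h _ => ?_
      rw [smul_smul, map_mul, mul_comm (D.χ g), mul_smul h g f]
    rw [sum_congr rfl fun g _ => h1 g, sum_comm]
    have h2 : ∀ h ∈ univ.filter (fun k => k ∈ H),
        ∑ g : G, D.χ (h * g) • (h * g) • f = D.anti ⊤ f := by
      intro h _
      rw [anti_apply]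
      simp only [Subgroup.mem_top, filter_true]
      exact Fintype.sum_equiv (Equiv.mulLeft h) _ _ (fun g => rfl)
    rw [sum_congr rfl h2, sum_const, ← Nat.cast_smul_eq_nsmul ℂ, Nat.card_eq_fintype_card,
      Fintype.card_subtype]
  -- quotient by right cosets
  let Q := Quotient (QuotientGroup.rightRel St)
  have hQ : Nat.card Q = St.index := by
    rw [Subgroup.index, Nat.card_congr (QuotientGroup.quotientRightRelEquivQuotientLeftRel St)]
  let c : G → ℂ := fun g => D.χ g * ψ (g * (Quotient.out (Quotient.mk (QuotientGroup.rightRel St) g))⁻¹)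
  have hg : ∀ g f, ε (D.χ g • D.Phi H (g • f)) =
      c g * ε (D.Phi H ((Quotient.out (Quotient.mk (QuotientGroup.rightRel St) g)) • f)) := by
    intro g f
    set r := Quotient.out (Quotient.mk (QuotientGroup.rightRel St) g) with hr
    have hmem : g * r⁻¹ ∈ St := by
      have := Quotient.exact (Quotient.out_eq (Quotient.mk (QuotientGroup.rightRel St) g))
      exact QuotientGroup.rightRel_apply.1 this
    have := hψ (g * r⁻¹) hmem (r • f)
    rw [smul_smul, inv_mul_cancel_right] at this
    rw [map_smul, this, smul_eq_mul, ← mul_assoc]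
  let a : ℂ := ((Nat.card H : ℂ) * ε u)⁻¹
  have hcard : (Nat.card H : ℂ) ≠ 0 := by exact_mod_cast Nat.card_pos.ne'
  have hform : ∀ f, ε (D.Phi ⊤ f) = ∑ q : Q, (a * ∑ g ∈ univ.filter
      (fun g => (Quotient.mk (QuotientGroup.rightRel St) g) = q), c g) * ε (D.Phi H (q.out • f)) := by
    intro f
    have h1 := congrArg ε (hsum f)
    rw [map_smul, map_mul, map_sum, sum_congr rfl (fun g _ => hg g f), smul_eq_mul,
      ← mul_assoc] at h1
    have h2 : ε (D.Phi ⊤ f) = a * ∑ g, c g * ε (D.Phi H ((Quotient.out (Quotient.mk (QuotientGroup.rightRel St) g)) • f)) := by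
      rw [← h1, ← mul_assoc, inv_mul_cancel₀ (mul_ne_zero hcard hεu), one_mul]
    rw [h2, ← sum_fiberwise univ (fun g => (Quotient.mk (QuotientGroup.rightRel St) g : Q)), mul_sum]
    refine sum_congr rfl fun q _ => ?_
    rw [mul_assoc, sum_mul]
    congr 1
    refine sum_congr rfl fun g hgq => ?_
    simp only [mem_filter, mem_univ, true_and] at hgq
    rw [hgq]
  let T : G → S →ₗ[ℂ] S := fun g => DistribSMul.toLinearMap ℂ S g
  have hB : D.B ⊤ ε = ∑ q : Q, ((a * ∑ g ∈ univ.filter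
      (fun g => (Quotient.mk (QuotientGroup.rightRel St) g) = q), c g) •
      (T q.out).dualMap) ∘ₗ (D.B H ε ∘ₗ T q.out) := by
    ext f h
    rw [B_apply, hform, LinearMap.sum_apply, LinearMap.sum_apply]
    refine sum_congr rfl fun q _ => ?_
    simp only [LinearMap.comp_apply, LinearMap.smul_apply, LinearMap.dualMap_apply, smul_eq_mul,
      B_apply, T, DistribSMul.toLinearMap_apply, smul_mul']
  rw [hB]
  refine (LinearMap.rank_finsetSum_le _ _).trans ?_
  refine (sum_le_sum fun q _ => (LinearMap.rank_comp_le_right _ _).trans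
    ((LinearMap.rank_comp_le_left _ _).trans (D.rank_B_le H ε))).trans ?_
  rw [sum_const, card_univ, ← Nat.card_eq_fintype_card, hQ, nsmul_eq_mul]
  push_cast
  exact le_rfl

end RD

namespace RD

variable (D : RD G S)

/-- The ideal generated by invariants vanishing at the point. -/
def Hilb (G : Type*) {S : Type*} [Group G] [CommRing S] [Algebra ℂ S] [MulSemiringAction G S]
    (ε : S →ₐ[ℂ] ℂ) : Ideal S := Ideal.span {r | (∀ g : G, g • r = r) ∧ ε r = 0}

lemma ker_le_radical (ε : S →ₐ[ℂ] ℂ) (hε : ∀ (g : G) f, ε (g • f) = ε f) :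
    RingHom.ker ε ≤ (Hilb G ε).radical := by
  intro x hx
  rw [RingHom.mem_ker] at hx
  let P := MulSemiringAction.charpoly G x
  refine ⟨P.natDegree, ?_⟩
  have h0 : P.eval x = 0 := MulSemiringAction.eval_charpoly G x
  have hmon : P.Monic := MulSemiringAction.monic_charpoly G x
  rw [Polynomial.eval_eq_sum_range, sum_range_succ, hmon.coeff_natDegree, one_mul] at h0
  rw [eq_neg_of_add_eq_zero_right h0]
  refine (Hilb G ε).neg_mem ((Hilb G ε).sum_mem fun i hi => ?_)
  refine (Hilb G ε).mul_mem_right _ (Ideal.subset_span ⟨fun g =>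
    MulSemiringAction.smul_coeff_charpoly _ _ _, ?_⟩)
  have hmap : P.map (ε : S →+* ℂ) = Polynomial.X ^ Fintype.card G := by
    simp only [P, MulSemiringAction.charpoly_eq, Polynomial.map_prod, Polynomial.map_sub,
      Polynomial.map_X, Polynomial.map_C]
    simp [hε, hx]
  have hdeg : P.natDegree = Fintype.card G := by
    have := hmon.natDegree_map (ε : S →+* ℂ)
    rw [hmap] at this
    simpa using this.symm
  have hc : ε (P.coeff i) = (P.map (ε : S →+* ℂ)).coeff i := by
    rw [Polynomial.coeff_map]; rfl
  rw [hc, hmap, Polynomial.coeff_X_pow, if_neg]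
  rw [mem_range] at hi
  omega

lemma smul_Hilb (ε : S →ₐ[ℂ] ℂ) (g : G) {p : S} (hp : p ∈ Hilb G ε) : g • p ∈ Hilb G ε := by
  refine Submodule.span_induction (p := fun x _ => g • x ∈ Hilb G ε) ?_ ?_ ?_ ?_ hp
  · intro r hr
    rw [hr.1 g]; exact Ideal.subset_span hr
  · rw [smul_zero]; exact zero_mem _
  · intro x y _ _ hx hy
    rw [smul_add]; exact add_mem hx hy
  · intro a x _ hx
    rw [smul_eq_mul, smul_mul']
    exact Ideal.mul_mem_left _ _ hx

lemma sub_smul_Hilb (ε : S →ₐ[ℂ] ℂ) {s : G} (hs : s ∈ D.refl) {p : S} (hp : p ∈ Hilb G ε) :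
    ∃ q ∈ Hilb G ε, p - s • p = D.α s * q := by
  have key : ∀ a : S, ∃ q ∈ Hilb G ε, a * p - s • (a * p) = D.α s * q := by
    refine Submodule.span_induction (p := fun x _ => ∀ a : S, ∃ q ∈ Hilb G ε,
      a * x - s • (a * x) = D.α s * q) ?_ ?_ ?_ ?_ hp
    · intro r hr a
      obtain ⟨b, hb⟩ := D.self_mem_C hs a
      refine ⟨-b * r, Ideal.mul_mem_left _ _ (Ideal.subset_span hr), ?_⟩
      rw [smul_mul', hr.1 s]
      linear_combination (-r) * hb
    · intro a; exact ⟨0, zero_mem _, by simp⟩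
    · intro x y _ _ hx hy a
      obtain ⟨q, hq, hq'⟩ := hx a
      obtain ⟨t, ht, ht'⟩ := hy a
      refine ⟨q + t, add_mem hq ht, ?_⟩
      rw [mul_add, smul_add, mul_add, ← hq', ← ht']; ring
    · intro b x _ hx a
      obtain ⟨q, hq, hq'⟩ := hx (a * b)
      refine ⟨q, hq, ?_⟩
      rw [smul_eq_mul, ← mul_assoc, hq']
  simpa using key 1

lemma ker_B_le [IsNoetherianRing S] (hgen : Subgroup.closure D.refl = ⊤) (ε : S →ₐ[ℂ] ℂ)
    (hε : ∀ (g : G) f, ε (g • f) = ε f) (hα : ∀ s ∈ D.refl, ε (D.α s) = 0)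
    {f : S} (hf : D.B ⊤ ε f = 0) : f ∈ Hilb G ε := by
  classical
  obtain ⟨N, hN⟩ := Ideal.exists_pow_le_of_le_radical_of_fg (ker_le_radical (G := G) ε hε)
    (IsNoetherian.noetherian _)
  have key : ∀ d : ℕ, ∀ f ∈ (RingHom.ker ε) ^ (N - d), D.B ⊤ ε f = 0 → f ∈ Hilb G ε := by
    intro d
    induction d with
    | zero => intro f hf _; exact hN hf
    | succ d ih =>
      intro f hf hB
      have h1 : ∀ s ∈ D.refl, f - D.χ s • s • f ∈ Hilb G ε := by
        intro s hs
        have h2 : D.α s * f ∈ Hilb G ε := by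
          apply ih
          · refine Ideal.pow_le_pow_right (show N - d ≤ (N - (d + 1)) + 1 by omega) ?_
            rw [pow_succ']
            exact Ideal.mul_mem_mul (hα s hs) hf
          · ext h
            rw [B_apply, mul_comm (D.α s), mul_assoc, ← B_apply, hB]; rfl
        obtain ⟨q, hq, hq'⟩ := D.sub_smul_Hilb ε hs h2
        have h3 : f - D.χ s • s • f = q := by
          apply mul_left_cancel₀ (D.prime s hs).ne_zero
          rw [← hq', smul_mul', D.eig s hs s (D.self_mem_C hs), mul_sub, mul_smul_comm,
            smul_mul_assoc]
        rw [h3]; exact hq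
      have h4 : ∀ g : G, f - D.χ g • g • f ∈ Hilb G ε := by
        let L : Subgroup G :=
          { carrier := {g | f - D.χ g • g • f ∈ Hilb G ε}
            one_mem' := by simp
            mul_mem' := by
              intro a b ha hb
              have h5 := smul_Hilb (G := G) ε a hb
              have h6 := add_mem (show f - D.χ a • a • f ∈ Hilb G ε from ha)
                (Submodule.smul_of_tower_mem (Hilb G ε) (D.χ a) h5)
              have e : f - D.χ (a * b) • (a * b) • f = f - D.χ a • a • f +
                  D.χ a • a • (f - D.χ b • b • f) := by
                rw [smul_sub a, smul_sub (D.χ a), smul_comm a (D.χ b), map_mul, mul_smul (D.χ a),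
                  mul_smul a b f]
                abel
              show _ ∈ Hilb G ε
              rw [e]; exact h6
            inv_mem' := by
              intro a ha
              have h5 := smul_Hilb (G := G) ε a⁻¹ ha
              have h6 := neg_mem (Submodule.smul_of_tower_mem (Hilb G ε) (D.χ a)⁻¹ h5)
              have e : f - D.χ a⁻¹ • a⁻¹ • f = -((D.χ a)⁻¹ • a⁻¹ • (f - D.χ a • a • f)) := by
                rw [smul_sub a⁻¹, smul_comm a⁻¹ (D.χ a), inv_smul_smul, smul_sub,
                  inv_smul_smul₀ (D.χ_ne a), χ_inv]
                abel
              show _ ∈ Hilb G ε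
              rw [e]; exact h6 }
        have hL : Subgroup.closure D.refl ≤ L := by
          rw [Subgroup.closure_le]; exact h1
        rw [hgen] at hL
        exact fun g => hL (Subgroup.mem_top g)
      have h7 : D.anti ⊤ f ∈ Hilb G ε := by
        rw [← J_mul_Phi]
        refine Ideal.mul_mem_left _ _ (Ideal.subset_span ⟨fun g => D.smul_Phi_top hgen g f, ?_⟩)
        have := congrArg (fun l => l 1) hB
        simpa [B_apply] using this
      have h8 : (Fintype.card G : ℂ) • f = D.anti ⊤ f + ∑ g : G, (f - D.χ g • g • f) := by
        rw [anti_apply, sum_sub_distrib]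
        simp [Nat.cast_smul_eq_nsmul]
      have h9 : (Fintype.card G : ℂ) • f ∈ Hilb G ε := by
        rw [h8]
        exact add_mem h7 (Ideal.sum_mem _ fun g _ => h4 g)
      have h10 := Submodule.smul_of_tower_mem (Hilb G ε) ((Fintype.card G : ℂ))⁻¹ h9
      rwa [inv_smul_smul₀] at h10
      exact_mod_cast Fintype.card_ne_zero
  exact key N f (by simp) hf

lemma card_le_rank_B [Algebra.FiniteType ℂ S] (hgen : Subgroup.closure D.refl = ⊤)
    (hfaith : ∀ g : G, (∀ f : S, g • f = f) → g = 1) (ε : S →ₐ[ℂ] ℂ)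
    (hε : ∀ (g : G) f, ε (g • f) = ε f) (hα : ∀ s ∈ D.refl, ε (D.α s) = 0) :
    ((Fintype.card G : ℕ) : Cardinal) ≤ (D.B ⊤ ε).rank := by
  classical
  by_contra hlt
  rw [not_le] at hlt
  have : IsNoetherianRing S := Algebra.FiniteType.isNoetherianRing ℂ S
  have hfd : Module.Finite ℂ (LinearMap.range (D.B ⊤ ε)) :=
    Module.rank_lt_aleph0_iff.1 (hlt.trans (Cardinal.natCast_lt_aleph0))
  let b := Module.finBasis ℂ (LinearMap.range (D.B ⊤ ε))
  have hm : Module.finrank ℂ (LinearMap.range (D.B ⊤ ε)) < Fintype.card G := by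
    have h1 : (D.B ⊤ ε).rank = (Module.finrank ℂ (LinearMap.range (D.B ⊤ ε)) : Cardinal) :=
      (Module.finrank_eq_rank _ _).symm
    rw [h1] at hlt
    exact_mod_cast hlt
  set m := Module.finrank ℂ (LinearMap.range (D.B ⊤ ε))
  choose f hf using fun i => (b i).2
  have hdec : ∀ x : S, ∃ c : Fin m → ℂ, x - ∑ i, c i • f i ∈ Hilb G ε := by
    intro x
    let y : LinearMap.range (D.B ⊤ ε) := ⟨D.B ⊤ ε x, x, rfl⟩
    refine ⟨fun i => b.repr y i, D.ker_B_le hgen ε hε hα ?_⟩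
    have h1 := congrArg (LinearMap.range (D.B ⊤ ε)).subtype (b.sum_repr y)
    rw [map_sum] at h1
    simp only [map_smul, Submodule.subtype_apply] at h1
    rw [map_sub, map_sum, sub_eq_zero]
    simp only [map_smul, hf]
    exact h1.symm
  let R := FixedPoints.subalgebra ℂ S G
  have : Algebra.IsInvariant R S G := ⟨fun b hb => ⟨⟨b, hb⟩, rfl⟩⟩
  have hIntegral : Algebra.IsIntegral R S := Algebra.IsInvariant.isIntegral R S G
  have hft : Algebra.FiniteType R S := Algebra.FiniteType.of_restrictScalars_finiteType ℂ R S
  have hfin : Module.Finite R S := Algebra.IsIntegral.finite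
  let 𝔭 : Ideal R := RingHom.ker (ε.comp R.val)
  let M : Submodule R S := Submodule.span R (Set.range f)
  have hI : ∀ x ∈ Hilb G ε, x ∈ 𝔭 • (⊤ : Submodule R S) := by
    intro x hx
    have key : ∀ a : S, a * x ∈ 𝔭 • (⊤ : Submodule R S) := by
      refine Submodule.span_induction (p := fun x _ => ∀ a : S,
        a * x ∈ 𝔭 • (⊤ : Submodule R S)) ?_ ?_ ?_ ?_ hx
      · intro r hr a
        have h1 : a * r = (⟨r, hr.1⟩ : R) • a := by
          rw [mul_comm]; rfl
        rw [h1]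
        exact Submodule.smul_mem_smul (show ε r = 0 from hr.2) trivial
      · intro a; rw [mul_zero]; exact zero_mem _
      · intro x y _ _ hx hy a
        rw [mul_add]; exact add_mem (hx a) (hy a)
      · intro c x _ hx a
        rw [smul_eq_mul, ← mul_assoc]; exact hx _
    simpa using key 1
  have htop : (⊤ : Submodule R (S ⧸ M)) ≤ 𝔭 • ⊤ := by
    intro z _
    obtain ⟨x, rfl⟩ := M.mkQ_surjective z
    obtain ⟨c, hc⟩ := hdec x
    have h1 : M.mkQ x = M.mkQ (x - ∑ i, c i • f i) := by
      rw [map_sub, eq_comm, sub_eq_self, Submodule.mkQ_apply, Submodule.Quotient.mk_eq_zero]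
      exact sum_mem fun i _ => Submodule.smul_of_tower_mem M (c i)
        (Submodule.subset_span ⟨i, rfl⟩)
    rw [h1]
    have h2 := Submodule.mem_map_of_mem (f := M.mkQ) (hI _ hc)
    rw [Submodule.map_smul''] at h2
    exact Submodule.smul_mono le_rfl le_top h2
  obtain ⟨r, hr1, hr2⟩ := Submodule.exists_sub_one_mem_and_smul_eq_zero_of_fg_of_le_smul 𝔭
    (⊤ : Submodule R (S ⧸ M)) Module.Finite.fg_top htop
  have hrM : ∀ x : S, r • x ∈ M := by
    intro x
    have := hr2 (M.mkQ x) trivial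
    rwa [← map_smul, Submodule.mkQ_apply, Submodule.Quotient.mk_eq_zero] at this
  have hr0 : (r : S) ≠ 0 := by
    intro h0
    have h1 : ε ((r : S) - 1) = 0 := hr1
    rw [h0] at h1
    simp at h1
  -- linear dependency
  let A : Matrix (Fin m) G S := Matrix.of fun i g => g • f i
  have hninj : ¬ Function.Injective A.mulVecLin := by
    intro hinj
    have := card_le_of_injective S A.mulVecLin hinj
    rw [Fintype.card_fin] at this
    omega
  rw [← LinearMap.ker_eq_bot, Submodule.eq_bot_iff] at hninj
  push Not at hninj
  obtain ⟨c, hc, hc0⟩ := hninj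
  have hcf : ∀ i, ∑ g : G, c g * g • f i = 0 := by
    intro i
    have := congrFun (LinearMap.mem_ker.1 hc) i
    simpa [A, Matrix.mulVec, dotProduct, mul_comm] using this
  have hcM : ∀ x ∈ M, ∑ g : G, c g * g • x = 0 := by
    intro x hx
    refine Submodule.span_induction (p := fun x _ => ∑ g : G, c g * g • x = 0) ?_ ?_ ?_ ?_ hx
    · rintro _ ⟨i, rfl⟩; exact hcf i
    · simp
    · intro x y _ _ hx hy
      simp only [smul_add, mul_add, sum_add_distrib, hx, hy, add_zero]
    · intro a x _ hx
      have h1 : ∀ g : G, c g * g • (a • x) = (a : S) * (c g * g • x) := by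
        intro g
        have h2 : g • (a • x) = (a : S) * g • x := by
          rw [show a • x = (a : S) * x from rfl, smul_mul', a.2 g]
        rw [h2]; ring
      rw [sum_congr rfl fun g _ => h1 g, ← mul_sum, hx, mul_zero]
  have hall : ∀ x : S, ∑ g : G, c g * g • x = 0 := by
    intro x
    have h1 := hcM _ (hrM x)
    have h2 : ∀ g : G, c g * g • (r • x) = (r : S) * (c g * g • x) := by
      intro g
      have h2 : g • (r • x) = (r : S) * g • x := by
        rw [show r • x = (r : S) * x from rfl, smul_mul', r.2 g]
      rw [h2]; ring
    rw [sum_congr rfl fun g _ => h2 g, ← mul_sum] at h1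
    exact (mul_eq_zero.1 h1).resolve_left hr0
  have hli := (linearIndependent_monoidHom S S).comp
    (fun g : G => ((MulSemiringAction.toRingHom G S g : S →+* S) : S →* S)) (by
      intro a b hab
      have h1 : ∀ x : S, a • x = b • x := fun x => DFunLike.congr_fun hab x
      have h2 := hfaith (b⁻¹ * a) (fun x => by rw [mul_smul, h1, inv_smul_smul])
      exact (inv_mul_eq_one.1 h2).symm)
  rw [Fintype.linearIndependent_iff] at hli
  apply hc0
  ext g
  refine hli c ?_ g
  ext x
  simpa [Finset.sum_apply] using hall x

/-- The abstract form of the theorem. -/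
theorem core [Algebra.FiniteType ℂ S] (hgen : Subgroup.closure D.refl = ⊤)
    (hfaith : ∀ g : G, (∀ f : S, g • f = f) → g = 1) (ε : ℂ → S →ₐ[ℂ] ℂ)
    (hpoly : ∀ f : S, ∃ p : Polynomial ℂ, ∀ t, ε t f = p.eval t)
    (hε : ∀ (g : G) f, ε 0 (g • f) = ε 0 f) (hα : ∀ s ∈ D.refl, ε 0 (D.α s) = 0)
    (H St : Subgroup G)
    (hSt : ∀ k ∈ St, ∀ t, ∀ f : S, ε t (k • f) = ε t f)
    (hnorm : ∀ k ∈ St, ∀ h, h ∈ H ↔ k * h * k⁻¹ ∈ H)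
    (hrefl : ∀ s ∈ D.refl, ∀ t ≠ 0, ε t (D.α s) = 0 → s ∈ H) (hle : H ≤ St) : H = St := by
  obtain ⟨f, h, hd⟩ := exists_det_ne _ _ (D.card_le_rank_B hgen hfaith (ε 0) hε hα)
  obtain ⟨p, hp⟩ := hpoly (Matrix.of fun i j => D.Phi ⊤ (f i * h j)).det
  have hdet : ∀ t, (Matrix.of fun i j => D.B ⊤ (ε t) (f i) (h j)).det = p.eval t := by
    intro t
    rw [← hp]
    exact (RingHom.map_det (ε t : S →+* ℂ) (Matrix.of fun i j => D.Phi ⊤ (f i * h j))).symm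
  have hp0 : p ≠ 0 := by
    intro h0
    rw [hdet, h0] at hd
    simp at hd
  have hp1 : p * Polynomial.X ≠ 0 := mul_ne_zero hp0 Polynomial.X_ne_zero
  obtain ⟨t, ht⟩ : ∃ t, (p * Polynomial.X).eval t ≠ 0 := by
    by_contra hall
    push Not at hall
    exact hp1 (Polynomial.funext (by simpa using hall))
  rw [Polynomial.eval_mul, Polynomial.eval_X] at ht
  have ht0 := right_ne_zero_of_mul ht
  have htp := left_ne_zero_of_mul ht
  rw [← hdet] at htp
  have h1 := le_rank_of_det _ _ f h htp
  have h2 := h1.trans (D.rank_B_top_le H St (ε t) (fun k hk => hSt k hk t) hnorm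
    (fun s hs => hrefl s hs t ht0))
  have h3 : Fintype.card G ≤ St.index * Nat.card H := by exact_mod_cast h2
  rw [← Nat.card_eq_fintype_card, ← St.index_mul_card] at h3
  have h4 : Nat.card St ≤ Nat.card H :=
    Nat.le_of_mul_le_mul_left h3 (Nat.pos_of_ne_zero Subgroup.index_ne_zero_of_finite)
  exact Subgroup.eq_of_le_of_card_ge hle h4

end RD

end Abstract

section Concrete

open MvPolynomial

variable {V : Type*} [AddCommGroup V] [Module ℂ V] {n : ℕ}
  (b : Module.Basis (Fin n) ℂ V)

/-- Linear forms. -/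
noncomputable def lin : V →ₗ[ℂ] MvPolynomial (Fin n) ℂ :=
  (sumSMulX).comp b.repr.toLinearMap

lemma lin_basis (i : Fin n) : lin b (b i) = X i := by
  simp [lin, sumSMulX]

lemma lin_prime {a : V} (ha : a ≠ 0) : Prime (lin b a) := by
  rw [← irreducible_iff_prime]
  have h0 : b.repr a ≠ 0 := by simpa using ha
  obtain ⟨i, hi⟩ := Finsupp.support_nonempty_iff.2 h0
  refine irreducible_sumSMulX _ ⟨i, hi⟩ ?_
  intro r hr
  refine Ne.isUnit ?_
  rintro rfl
  have := hr i
  rw [zero_dvd_iff] at this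
  exact (Finsupp.mem_support_iff.1 hi) this

/-- Evaluation at a functional. -/
noncomputable def ev (ν : Module.Dual ℂ V) : MvPolynomial (Fin n) ℂ →ₐ[ℂ] ℂ :=
  aeval (fun i => ν (b i))

lemma ev_lin (ν : Module.Dual ℂ V) (x : V) : ev b ν (lin b x) = ν x := by
  have : (ev b ν).toLinearMap ∘ₗ lin b = ν := by
    refine b.ext fun i => ?_
    simp [lin_basis, ev]
  exact LinearMap.congr_fun this x

lemma lin_dvd {a y : V} (h : lin b a ∣ lin b y) : ∃ c : ℂ, y = c • a := by
  by_contra hne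
  have hy : y ∉ Submodule.span ℂ {a} := by
    rw [Submodule.mem_span_singleton]
    rintro ⟨c, hc⟩
    exact hne ⟨c, hc.symm⟩
  obtain ⟨ν, hν, hle⟩ := Submodule.exists_le_ker_of_notMem hy
  obtain ⟨p, hp⟩ := h
  have h1 := congrArg (ev b ν) hp
  rw [map_mul, ev_lin, ev_lin] at h1
  have h2 : ν a = 0 := hle (Submodule.mem_span_singleton_self a)
  rw [h2, zero_mul] at h1
  exact hν h1

variable {G : Type*} [Group G] (ρ : G →* (V ≃ₗ[ℂ] V))

/-- Action on polynomials. -/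
noncomputable def act (g : G) : MvPolynomial (Fin n) ℂ →ₐ[ℂ] MvPolynomial (Fin n) ℂ :=
  aeval (fun i => lin b (ρ g (b i)))

lemma act_lin (g : G) (x : V) : act b ρ g (lin b x) = lin b (ρ g x) := by
  have : (act b ρ g).toLinearMap ∘ₗ lin b = lin b ∘ₗ (ρ g).toLinearMap := by
    refine b.ext fun i => ?_
    simp [lin_basis, act]
  exact LinearMap.congr_fun this x

lemma act_one : act b ρ 1 = AlgHom.id ℂ _ := by
  ext1 i
  simp [act, lin_basis]

lemma act_mul (g h : G) : act b ρ (g * h) = (act b ρ g).comp (act b ρ h) := by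
  ext1 i
  rw [AlgHom.comp_apply, ← lin_basis b i, act_lin, act_lin, act_lin, map_mul]
  rfl

/-- The action as a `MulSemiringAction`. -/
@[reducible] noncomputable def actInst : MulSemiringAction G (MvPolynomial (Fin n) ℂ) where
  smul g f := act b ρ g f
  one_smul f := by
    show act b ρ 1 f = f
    rw [act_one]; rfl
  mul_smul g h f := by
    show act b ρ (g * h) f = act b ρ g (act b ρ h f)
    rw [act_mul]; rfl
  smul_zero g := map_zero (act b ρ g)
  smul_add g := map_add (act b ρ g)
  smul_one g := map_one (act b ρ g)
  smul_mul g := map_mul (act b ρ g)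

lemma ev_act (ν : Module.Dual ℂ V) (g : G) (f : MvPolynomial (Fin n) ℂ) :
    ev b ν (act b ρ g f) = ev b (ν.comp (ρ g).toLinearMap) f := by
  have : (ev b ν).comp (act b ρ g) = ev b (ν.comp (ρ g).toLinearMap) := by
    ext1 i
    rw [AlgHom.comp_apply, ← lin_basis b i, act_lin, ev_lin, ev_lin]
    rfl
  exact DFunLike.congr_fun this f

/-- `a` is a root of `g`. -/
def IsRoot (g : G) (a : V) : Prop := ∀ x, ∃ c : ℂ, ρ g x - x = c • a

lemma dvd_iff_isRoot (g : G) (a : V) :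
    (∀ f, lin b a ∣ act b ρ g f - f) ↔ IsRoot ρ g a := by
  constructor
  · intro h x
    have := h (lin b x)
    rw [act_lin, ← map_sub] at this
    exact lin_dvd b this
  · intro h f
    induction f using MvPolynomial.induction_on with
    | C c => simp [act]
    | add p q hp hq =>
      have := dvd_add hp hq
      rw [map_add]
      convert this using 1
      ring
    | mul_X p i hp =>
      obtain ⟨c, hc⟩ := h (b i)
      have h1 : lin b a ∣ act b ρ g (X i) - X i := by
        rw [← lin_basis b i, act_lin, ← map_sub, hc, map_smul]
        exact dvd_smul_of_dvd _ dvd_rfl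
      have h2 := dvd_add (hp.mul_right (act b ρ g (X i))) (h1.mul_left p)
      rw [map_mul]
      convert h2 using 1
      ring

lemma IsRoot.exists_form {ρ : G →* (V ≃ₗ[ℂ] V)} {g : G} {a : V} (h : IsRoot ρ g a) (ha : a ≠ 0) :
    ∃ φ : Module.Dual ℂ V, ∀ x, ρ g x = x + φ x • a := by
  obtain ⟨θ, hθ⟩ := Module.Projective.exists_dual_eq_one ℂ ha
  refine ⟨θ ∘ₗ ((ρ g).toLinearMap - LinearMap.id), fun x => ?_⟩
  obtain ⟨c, hc⟩ := h x
  simp only [LinearMap.comp_apply, LinearMap.sub_apply, LinearEquiv.coe_coe, LinearMap.id_apply, hc,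
    map_smul, hθ, smul_eq_mul, mul_one]
  rw [← hc]; abel

lemma IsRoot.eig [FiniteDimensional ℂ V] {ρ : G →* (V ≃ₗ[ℂ] V)} {g : G} {a : V} (h : IsRoot ρ g a) (ha : a ≠ 0) :
    ρ g a = LinearMap.det (ρ g).toLinearMap • a := by
  obtain ⟨φ, hφ⟩ := h.exists_form ha
  have : (ρ g).toLinearMap = LinearMap.transvection φ a := by
    ext x
    rw [LinearMap.transvection.apply]
    exact hφ x
  rw [this, LinearMap.transvection.det, hφ, add_smul, one_smul]

lemma IsRoot.inj [FiniteDimensional ℂ V] [Finite G] {ρ : G →* (V ≃ₗ[ℂ] V)} (hρ : Function.Injective ρ) {g : G} {a : V}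
    (h : IsRoot ρ g a) (ha : a ≠ 0) (hd : LinearMap.det (ρ g).toLinearMap = 1) : g = 1 := by
  obtain ⟨φ, hφ⟩ := h.exists_form ha
  have h1 := h.eig ha
  rw [hd, one_smul] at h1
  have hpow : ∀ (k : ℕ) x, ρ (g ^ k) x = x + ((k : ℂ) * φ x) • a := by
    intro k
    induction k with
    | zero => intro x; simp
    | succ k ih =>
      intro x
      rw [pow_succ', map_mul, LinearEquiv.mul_apply, ih, map_add, map_smul, h1, hφ]
      push_cast
      module
  apply hρ
  rw [map_one]
  ext x
  have h2 := hpow (orderOf g) x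
  rw [pow_orderOf_eq_one, map_one, LinearEquiv.coe_one, id, eq_comm, add_eq_left] at h2
  have h3 := (smul_eq_zero.1 h2).resolve_right ha
  have h4 : φ x = 0 := (mul_eq_zero.1 h3).resolve_left (by exact_mod_cast (orderOf_pos g).ne')
  rw [hφ, h4]; simp

lemma exists_moved {ρ : G →* (V ≃ₗ[ℂ] V)} (hρ : Function.Injective ρ) {g : G} (hg : g ≠ 1) : ∃ x, ρ g x - x ≠ 0 := by
  by_contra h
  push Not at h
  apply hg
  apply hρ
  ext x
  rw [map_one]
  exact sub_eq_zero.1 (h x)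

lemma IsRoot.unique {ρ : G →* (V ≃ₗ[ℂ] V)} (hρ : Function.Injective ρ) {g : G} (hg : g ≠ 1) {a a' : V}
    (h : IsRoot ρ g a) (h' : IsRoot ρ g a') : ∃ c : ℂ, c ≠ 0 ∧ a = c • a' := by
  obtain ⟨x, hx⟩ := exists_moved hρ hg
  obtain ⟨c, hc⟩ := h x
  obtain ⟨d, hd⟩ := h' x
  have hc0 : c ≠ 0 := by rintro rfl; simp [hc] at hx
  have hd0 : d ≠ 0 := by rintro rfl; simp [hd] at hx
  refine ⟨c⁻¹ * d, mul_ne_zero (inv_ne_zero hc0) hd0, ?_⟩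
  rw [mul_smul, ← hd, hc, inv_smul_smul₀ hc0]

lemma refl_iff [FiniteDimensional ℂ V] {ρ : G →* (V ≃ₗ[ℂ] V)} (hρ : Function.Injective ρ) (g : G) :
    IsReflectionOn ρ g ↔ g ≠ 1 ∧ ∃ a, a ≠ 0 ∧ IsRoot ρ g a := by
  set T := (ρ g).toLinearMap - LinearMap.id with hT
  have hrn := LinearMap.finrank_range_add_finrank_ker T
  have hTx : ∀ x, T x = ρ g x - x := fun x => rfl
  constructor
  · rintro ⟨h1, h2⟩
    refine ⟨h1, ?_⟩
    obtain ⟨x, hx⟩ := exists_moved hρ h1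
    have hpos : 0 < Module.finrank ℂ V :=
      Module.finrank_pos_iff_exists_ne_zero.2 ⟨_, hx⟩
    have h3 : Module.finrank ℂ (LinearMap.range T) = 1 := by
      rw [← hT] at h2
      omega
    obtain ⟨v, hv, hv'⟩ := finrank_eq_one_iff'.1 h3
    refine ⟨v, fun h0 => hv (Subtype.ext h0), fun y => ?_⟩
    obtain ⟨c, hc⟩ := hv' ⟨T y, y, rfl⟩
    exact ⟨c, (congrArg Subtype.val hc).symm⟩
  · rintro ⟨h1, a, ha, hr⟩
    refine ⟨h1, ?_⟩
    obtain ⟨x, hx⟩ := exists_moved hρ h1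
    have h3 : Module.finrank ℂ (LinearMap.range T) = 1 := by
      rw [finrank_eq_one_iff']
      refine ⟨⟨T x, x, rfl⟩, fun h0 => hx (congrArg Subtype.val h0), ?_⟩
      rintro ⟨_, y, rfl⟩
      obtain ⟨c, hc⟩ := hr x
      obtain ⟨d, hd⟩ := hr y
      have hc0 : c ≠ 0 := by rintro rfl; simp [hc] at hx
      refine ⟨d * c⁻¹, Subtype.ext ?_⟩
      show (d * c⁻¹) • T x = T y
      rw [hTx, hTx, hc, hd, mul_smul, inv_smul_smul₀ hc0]
    rw [← hT]
    omega

lemma IsRoot.conj {ρ : G →* (V ≃ₗ[ℂ] V)} {s : G} {a : V} (h : IsRoot ρ s a) (g : G) :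
    IsRoot ρ (g * s * g⁻¹) (ρ g a) := by
  intro x
  obtain ⟨c, hc⟩ := h (ρ g⁻¹ x)
  refine ⟨c, ?_⟩
  have h1 : ρ g (ρ g⁻¹ x) = x := by
    rw [← LinearEquiv.mul_apply, ← map_mul]; simp
  rw [← map_smul, ← hc, map_sub, h1, map_mul, map_mul]
  rfl

lemma assoc_smul {c : ℂ} (hc : c ≠ 0) (p : MvPolynomial (Fin n) ℂ) : Associated p (c • p) := by
  refine associated_of_dvd_dvd (dvd_smul_of_dvd _ dvd_rfl) ?_
  have : p = c⁻¹ • (c • p) := (inv_smul_smul₀ hc p).symm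
  conv_rhs => rw [this]
  exact dvd_smul_of_dvd _ dvd_rfl

open scoped Classical in
/-- A chosen root. -/
noncomputable def root (g : G) : V :=
  if h : ∃ a, a ≠ 0 ∧ IsRoot ρ g a then h.choose else 0

lemma root_spec [FiniteDimensional ℂ V] {ρ : G →* (V ≃ₗ[ℂ] V)} (hρ : Function.Injective ρ) {g : G}
    (hg : IsReflectionOn ρ g) : root ρ g ≠ 0 ∧ IsRoot ρ g (root ρ g) := by
  have h := ((refl_iff hρ g).1 hg).2
  rw [root, dif_pos h]
  exact h.choose_spec

/-- The concrete data. -/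
noncomputable def data [FiniteDimensional ℂ V] [Finite G] (hρ : Function.Injective ρ) :
    letI := actInst b ρ
    RD G (MvPolynomial (Fin n) ℂ) :=
  letI := actInst b ρ
  { refl := {g | IsReflectionOn ρ g}
    α := fun g => lin b (root ρ g)
    χ := LinearMap.det.comp ((LinearEquiv.automorphismGroup.toLinearMapMonoidHom).comp ρ)
    prime := fun s hs => lin_prime b (root_spec hρ hs).1
    eig := by
      intro s hs g hg
      have h1 := (dvd_iff_isRoot b ρ g _).1 hg
      have h2 := h1.eig (root_spec hρ hs).1
      show act b ρ g (lin b (root ρ s)) = _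
      rw [act_lin, h2, map_smul]
      rfl
    inj := by
      intro s hs g hg hd
      have h1 := (dvd_iff_isRoot b ρ g _).1 hg
      exact h1.inj hρ (root_spec hρ hs).1 hd
    memC := by
      intro s hs g
      refine (dvd_iff_isRoot b ρ g _).trans ?_
      have hs' := root_spec hρ hs
      constructor
      · intro h
        by_cases hg : g = 1
        · exact Or.inl hg
        have hgr : IsReflectionOn ρ g := (refl_iff hρ g).2 ⟨hg, _, hs'.1, h⟩
        refine Or.inr ⟨hgr, ?_⟩
        obtain ⟨c, hc, hca⟩ := (root_spec hρ hgr).2.unique hρ hg h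
        rw [hca, map_smul]
        exact assoc_smul hc _
      · rintro (rfl | ⟨hgr, hass⟩)
        · intro x; exact ⟨0, by simp⟩
        · intro x
          obtain ⟨c, hc⟩ := (root_spec hρ hgr).2 x
          obtain ⟨d, hd⟩ := lin_dvd b hass.dvd
          exact ⟨c * d, by rw [hc, hd, mul_smul]⟩
    ne_one := fun h => h.1 rfl
    conj_mem := by
      intro s hs g
      have hs' := root_spec hρ hs
      refine (refl_iff hρ _).2 ⟨?_, ρ g (root ρ s), by simpa using hs'.1, hs'.2.conj g⟩
      intro h
      exact hs.1 (conj_eq_one_iff.1 h)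
    conj_root := by
      intro s hs g
      have hs' := root_spec hρ hs
      have hne : g * s * g⁻¹ ≠ 1 := fun h => hs.1 (conj_eq_one_iff.1 h)
      have hgr : IsReflectionOn ρ (g * s * g⁻¹) :=
        (refl_iff hρ _).2 ⟨hne, ρ g (root ρ s), by simpa using hs'.1, hs'.2.conj g⟩
      obtain ⟨c, -, hc⟩ := (hs'.2.conj g).unique hρ hne (root_spec hρ hgr).2
      refine ⟨c, ?_⟩
      show act b ρ g (lin b (root ρ s)) = _
      rw [act_lin, hc, map_smul] }

end Concrete

end SteinbergAux

theorem stmt_7 {𝔥 : Type*} [AddCommGroup 𝔥] [Module ℂ 𝔥] [FiniteDimensional ℂ 𝔥]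
    {G : Type*} [Group G] [Finite G] (ρ : G →* (𝔥 ≃ₗ[ℂ] 𝔥))
    (hfaithful : Function.Injective ρ)
    (hgen : Subgroup.closure {g : G | IsReflectionOn ρ g} = ⊤)
    (μ : Module.Dual ℂ 𝔥) :
    ∀ g : G, μ.comp (ρ g).toLinearMap = μ ↔
      g ∈ Subgroup.closure
        {g : G | IsReflectionOn ρ g ∧ μ.comp (ρ g).toLinearMap = μ} := by
  classical
  have := Fintype.ofFinite G
  let b := Module.finBasis ℂ 𝔥
  letI := SteinbergAux.actInst b ρ
  have hcomm : SMulCommClass G ℂ (MvPolynomial (Fin (Module.finrank ℂ 𝔥)) ℂ) :=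
    ⟨fun g c f => map_smul (SteinbergAux.act b ρ g) c f⟩
  let D := SteinbergAux.data b ρ hfaithful
  let St : Subgroup G :=
    { carrier := {g | μ.comp (ρ g).toLinearMap = μ}
      one_mem' := by
        show μ.comp (ρ 1).toLinearMap = μ
        ext x; simp
      mul_mem' := by
        intro g h hg hh
        have hg' : ∀ x, μ (ρ g x) = μ x := fun x => LinearMap.congr_fun hg x
        have hh' : ∀ x, μ (ρ h x) = μ x := fun x => LinearMap.congr_fun hh x
        show μ.comp (ρ (g * h)).toLinearMap = μ
        ext x
        rw [map_mul]
        show μ (ρ g (ρ h x)) = μ x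
        rw [hg', hh']
      inv_mem' := by
        intro g hg
        have hg' : ∀ x, μ (ρ g x) = μ x := fun x => LinearMap.congr_fun hg x
        show μ.comp (ρ g⁻¹).toLinearMap = μ
        ext x
        show μ (ρ g⁻¹ x) = μ x
        rw [← hg' (ρ g⁻¹ x), ← LinearEquiv.mul_apply, ← map_mul]
        simp }
  have hmemSt : ∀ g, g ∈ St ↔ μ.comp (ρ g).toLinearMap = μ := fun g => Iff.rfl
  let H : Subgroup G := Subgroup.closure
    {g : G | IsReflectionOn ρ g ∧ μ.comp (ρ g).toLinearMap = μ}
  have hle : H ≤ St := by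
    rw [Subgroup.closure_le]
    intro g hg
    exact hg.2
  have hconj : ∀ k ∈ St, ∀ h ∈ H, k * h * k⁻¹ ∈ H := by
    intro k hk
    have : H ≤ H.comap (MulAut.conj k).toMonoidHom := by
      rw [Subgroup.closure_le]
      intro s hs
      refine Subgroup.subset_closure ⟨D.conj_mem s hs.1 k, ?_⟩
      exact St.mul_mem (St.mul_mem hk hs.2) (St.inv_mem hk)
    exact fun h hh => this hh
  have key : H = St := by
    refine D.core hgen ?_ (fun t => SteinbergAux.ev b (t • μ)) ?_ ?_ ?_ H St ?_ ?_ ?_ hle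
    · intro g hg
      by_contra hne
      obtain ⟨x, hx⟩ := SteinbergAux.exists_moved hfaithful hne
      obtain ⟨ν, hν⟩ := Module.Projective.exists_dual_eq_one ℂ hx
      have h1 : SteinbergAux.act b ρ g (SteinbergAux.lin b x) = SteinbergAux.lin b x := hg _
      rw [SteinbergAux.act_lin] at h1
      have h2 := congrArg (SteinbergAux.ev b ν) h1
      rw [SteinbergAux.ev_lin, SteinbergAux.ev_lin] at h2
      rw [map_sub, h2, sub_self] at hν
      exact zero_ne_one hν
    · intro f
      refine ⟨MvPolynomial.aeval (fun i => Polynomial.C (μ (b i)) * Polynomial.X) f, fun t => ?_⟩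
      have h1 : SteinbergAux.ev b (t • μ) = (Polynomial.aeval t).comp
          (MvPolynomial.aeval (fun i => Polynomial.C (μ (b i)) * Polynomial.X)) := by
        ext1 i
        simp [SteinbergAux.ev]
        exact mul_comm _ _
      rw [h1, AlgHom.comp_apply, Polynomial.coe_aeval_eq_eval]
    · intro g f
      show SteinbergAux.ev b _ (SteinbergAux.act b ρ g f) = _
      rw [SteinbergAux.ev_act]
      simp
    · intro s hs
      show SteinbergAux.ev b _ (SteinbergAux.lin b _) = 0
      rw [SteinbergAux.ev_lin]
      simp
    · intro k hk t f
      show SteinbergAux.ev b _ (SteinbergAux.act b ρ k f) = _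
      rw [SteinbergAux.ev_act, LinearMap.smul_comp, (hmemSt k).1 hk]
    · intro k hk h
      refine ⟨hconj k hk h, fun hh => ?_⟩
      have := hconj k⁻¹ (St.inv_mem hk) _ hh
      have e : k⁻¹ * (k * h * k⁻¹) * k⁻¹⁻¹ = h := by group
      rwa [e] at this
    · intro s hs t ht h0
      have h1 : SteinbergAux.ev b (t • μ) (SteinbergAux.lin b (SteinbergAux.root ρ s)) = 0 := h0
      rw [SteinbergAux.ev_lin, LinearMap.smul_apply, smul_eq_mul] at h1
      have h2 := (mul_eq_zero.1 h1).resolve_left ht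
      refine Subgroup.subset_closure ⟨hs, ?_⟩
      ext x
      obtain ⟨c, hc⟩ := (SteinbergAux.root_spec hfaithful hs).2 x
      have h3 := congrArg μ hc
      rw [map_sub, map_smul, h2, smul_zero, sub_eq_zero] at h3
      exact h3
  intro g
  rw [← hmemSt, ← key]
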